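/- arXiv:1905.07020 — 8 statements merged into one kernel-verified Lean document; each statement's English description precedes it below -/
import Mathlib

section
/- Let T ≥ 1 and D ≥ 0 be integers, let 0 = t(0) < t(1) < ... < t(D) ≤ T be integer delivery times, set I(m) = t(m) − t(m−1) for m = 1,...,D and R = T − t(D), and let z(0), z(1), ..., z(D) be nonnegative reals with z(0) = 0. Define h : {1,...,T} → ℝ by h(t) = z(m−1) + (t − t(m−1)) whenever t(m−1) < t ≤ t(m) for some m ∈ {1,...,D}, and h(t) = z(D) + (t − t(D)) whenever t(D) < t ≤ T. Then (1/T) Σ_{t=1}^T h(t) ≥ (1/2) ( T/(D+1) + 1 ). -/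
theorem aoi_block (h : ℕ → ℝ) (a n : ℕ)
    (H : ∀ s, a < s → s ≤ a + n → (s : ℝ) - (a : ℝ) ≤ h s) :
    ∑ s ∈ Finset.Icc 1 a, h s + (n : ℝ) * (n + 1) / 2 ≤ ∑ s ∈ Finset.Icc 1 (a + n), h s := by
  induction n with
  | zero => simp
  | succ k ih =>
    have h1 := ih (fun s hs hs' => H s hs (by omega))
    have h2 := H (a + k + 1) (by omega) (by omega)
    rw [← add_assoc, Finset.sum_Icc_succ_top (by omega)]
    push_cast at h2 ⊢
    linarith

theorem aoi_block_tangent (h : ℕ → ℝ) (a b : ℕ) (c : ℝ) (hab : a ≤ b)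
    (H : ∀ s, a < s → s ≤ b → (s : ℝ) - (a : ℝ) ≤ h s) :
    ∑ s ∈ Finset.Icc 1 a, h s + ((2 * c + 1) * ((b : ℝ) - a) - c ^ 2) / 2
      ≤ ∑ s ∈ Finset.Icc 1 b, h s := by
  obtain ⟨n, rfl⟩ := Nat.exists_eq_add_of_le hab
  have := aoi_block h a n H
  push_cast
  nlinarith [sq_nonneg ((n : ℝ) - c)]

/-- Deterministic sample-path lower bound on the time-average Age of Information:
with `D` deliveries in a horizon of `T` slots, the time-average AoI is at least
`(1/2) (T/(D+1) + 1)`. -/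
theorem aoi_sample_path_lower_bound
    (T D : ℕ) (hT : 1 ≤ T)
    (tt : ℕ → ℕ) (z : ℕ → ℝ) (h : ℕ → ℝ)
    (ht0 : tt 0 = 0)
    (hmono : ∀ m, 1 ≤ m → m ≤ D → tt (m - 1) < tt m)
    (htD : tt D ≤ T)
    (hz0 : z 0 = 0)
    (hznn : ∀ m, m ≤ D → 0 ≤ z m)
    (hh1 : ∀ m, 1 ≤ m → m ≤ D → ∀ s, tt (m - 1) < s → s ≤ tt m →
      h s = z (m - 1) + ((s : ℝ) - (tt (m - 1) : ℝ)))
    (hh2 : ∀ s, tt D < s → s ≤ T → h s = z D + ((s : ℝ) - (tt D : ℝ))) :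
    (1 / (T : ℝ)) * ∑ s ∈ Finset.Icc 1 T, h s ≥
      (1 / 2) * ((T : ℝ) / ((D : ℝ) + 1) + 1) := by
  have key : ∀ c : ℝ, ∀ m, m ≤ D →
      ((2 * c + 1) * (tt m : ℝ) - m * c ^ 2) / 2 ≤ ∑ s ∈ Finset.Icc 1 (tt m), h s := by
    intro c m
    induction m with
    | zero => intro _; simp [ht0]
    | succ k ih =>
      intro hk
      have h1 := ih (by omega)
      have hm := hmono (k + 1) (by omega) hk
      have hb := hh1 (k + 1) (by omega) hk
      simp only [Nat.add_sub_cancel] at hm hb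
      have h2 := aoi_block_tangent h (tt k) (tt (k + 1)) c hm.le (fun s hs hs' => by
        rw [hb s hs hs']
        linarith [hznn k (by omega)])
      push_cast
      linarith
  have hD : (0 : ℝ) < (D : ℝ) + 1 := by positivity
  have hTp : (0 : ℝ) < (T : ℝ) := by exact_mod_cast hT
  obtain ⟨c, hc⟩ : ∃ c : ℝ, c = (T : ℝ) / ((D : ℝ) + 1) := ⟨_, rfl⟩
  have hcT : c * ((D : ℝ) + 1) = T := by rw [hc]; field_simp
  have h1 := key c D le_rfl
  have h2 := aoi_block_tangent h (tt D) T c htD (fun s hs hs' => by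
    rw [hh2 s hs hs']
    linarith [hznn D le_rfl])
  have h3 : ((D : ℝ) + 1) * c ^ 2 = T * c := by rw [← hcT]; ring
  rw [← hc, ge_iff_le, one_div_mul_eq_div (T : ℝ), le_div_iff₀ hTp]
  linarith
end

section
/- Let N ≥ 1 be an integer and let w_i > 0, p_i ∈ (0,1], λ_i ∈ (0,1] for i = 1,...,N, and let q* be the unique minimizer of f(q) = (1/(2N)) Σ_{i=1}^N w_i (1/q_i + 1) over F = {q ∈ ℝ^N : 0 < q_i ≤ λ_i for all i, Σ_{i=1}^N q_i/p_i ≤ 1}. Then either (a) Σ_{i=1}^N λ_i/p_i ≤ 1 and q*_i = λ_i for every i, or (b) there exists γ > 0 such that q*_i = min{ λ_i, √(w_i p_i / (2Nγ)) } for every i and Σ_{i=1}^N q*_i/p_i = 1. -/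
/-- KKT characterization of the unique minimizer of the Age of Information
lower-bound problem: either all arrival-rate constraints are active (case (a)),
or there is a multiplier `γ > 0` with `q*_i = min{λ_i, √(w_i p_i/(2Nγ))}` and the
resource constraint tight (case (b)). -/
theorem lower_bound_kkt_characterization
    (N : ℕ) (hN : 1 ≤ N) (w p lam : Fin N → ℝ)
    (hw : ∀ i, 0 < w i)
    (hp : ∀ i, 0 < p i ∧ p i ≤ 1)
    (hlam : ∀ i, 0 < lam i ∧ lam i ≤ 1)
    (q : Fin N → ℝ)
    (hfeas : (∀ i, 0 < q i ∧ q i ≤ lam i) ∧ ∑ i, q i / p i ≤ 1)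
    (hmin : ∀ q' : Fin N → ℝ,
      ((∀ i, 0 < q' i ∧ q' i ≤ lam i) ∧ ∑ i, q' i / p i ≤ 1) →
      (1 / (2 * (N : ℝ))) * ∑ i, w i * (1 / q i + 1) ≤
        (1 / (2 * (N : ℝ))) * ∑ i, w i * (1 / q' i + 1)) :
    (∑ i, lam i / p i ≤ 1 ∧ ∀ i, q i = lam i) ∨
    (∃ γ : ℝ, 0 < γ ∧
      (∀ i, q i = min (lam i) (Real.sqrt (w i * p i / (2 * (N : ℝ) * γ)))) ∧
      ∑ i, q i / p i = 1) := by
  have hNpos : (0:ℝ) < N := by exact_mod_cast hN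
  have hc : 0 < 1 / (2 * (N : ℝ)) := by positivity
  obtain ⟨hq, hqs⟩ := hfeas
  have hmin' : ∀ q' : Fin N → ℝ,
      ((∀ i, 0 < q' i ∧ q' i ≤ lam i) ∧ ∑ i, q' i / p i ≤ 1) →
      ∑ i, (w i / q i - w i / q' i) ≤ 0 := by
    intro q' h
    have h1 := le_of_mul_le_mul_left (hmin q' h) hc
    have h2 : ∑ i, (w i / q i - w i / q' i)
        = ∑ i, w i * (1 / q i + 1) - ∑ i, w i * (1 / q' i + 1) := by
      rw [← Finset.sum_sub_distrib]
      exact Finset.sum_congr rfl fun i _ => by ring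
    linarith
  by_cases hL : ∑ i, lam i / p i ≤ 1
  · left
    refine ⟨hL, ?_⟩
    have h1 := hmin' lam ⟨fun i => ⟨(hlam i).1, le_rfl⟩, hL⟩
    have h2 : ∀ i ∈ Finset.univ, 0 ≤ w i / q i - w i / lam i := fun i _ =>
      sub_nonneg.2 (div_le_div_of_nonneg_left (hw i).le (hq i).1 (hq i).2)
    have h3 := (Finset.sum_eq_zero_iff_of_nonneg h2).1 (le_antisymm h1 (Finset.sum_nonneg h2))
    intro i
    have h4 := h3 i (Finset.mem_univ i)
    have hqi := (hq i).1
    have hli := (hlam i).1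
    have hwi := hw i
    rw [sub_eq_zero, div_eq_div_iff hqi.ne' hli.ne'] at h4
    exact (mul_left_cancel₀ hwi.ne' h4).symm
  · right
    push Not at hL
    set s : Fin N → ℝ := fun i => Real.sqrt (w i * p i / (2 * (N : ℝ))) with hs
    have hspos : ∀ i, 0 < s i := fun i => Real.sqrt_pos.2 (by
      have := hw i
      have := (hp i).1
      positivity)
    have hssq : ∀ i, s i ^ 2 = w i * p i / (2 * (N : ℝ)) := fun i => Real.sq_sqrt (by
      have := hw i
      have := (hp i).1
      positivity)
    let T : ℝ := ∑ i, lam i / s i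
    have hTnn : ∀ i ∈ Finset.univ, 0 ≤ lam i / s i := fun i _ =>
      (div_pos (hlam i).1 (hspos i)).le
    have hT0 : 0 ≤ T := Finset.sum_nonneg hTnn
    have hTi : ∀ i, lam i ≤ T * s i := fun i => by
      rw [← div_le_iff₀ (hspos i)]
      exact Finset.single_le_sum hTnn (Finset.mem_univ i)
    let g : ℝ → ℝ := fun t => ∑ i, min (lam i) (t * s i) / p i
    have hg : Continuous g := by
      refine continuous_finsetSum _ fun i _ => ?_
      exact (continuous_const.min (continuous_id.mul continuous_const)).div_const _
    have hg0 : g 0 = 0 := by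
      refine Finset.sum_eq_zero fun i _ => ?_
      rw [zero_mul, min_eq_right (hlam i).1.le, zero_div]
    have hgT : g T = ∑ i, lam i / p i :=
      Finset.sum_congr rfl fun i _ => by rw [min_eq_left (hTi i)]
    obtain ⟨t, ht, hgt⟩ := intermediate_value_Icc hT0 hg.continuousOn
      (show (1:ℝ) ∈ Set.Icc (g 0) (g T) by
        rw [hg0, hgT]
        exact ⟨zero_le_one, hL.le⟩)
    have htpos : 0 < t := by
      rcases ht.1.eq_or_lt with h | h
      · rw [← h, hg0] at hgt
        norm_num at hgt
      · exact h
    set r : Fin N → ℝ := fun i => min (lam i) (t * s i) with hr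
    have hrpos : ∀ i, 0 < r i := fun i => lt_min (hlam i).1 (mul_pos htpos (hspos i))
    have hrs : ∑ i, r i / p i = 1 := hgt
    have h1 := hmin' r ⟨fun i => ⟨hrpos i, min_le_left _ _⟩, hrs.le⟩
    have hterm : ∀ i ∈ Finset.univ, w i * (q i - r i) ^ 2 / (q i * r i ^ 2)
        ≤ (w i / q i - w i / r i) + 2 * N / t ^ 2 * (q i / p i - r i / p i) := by
      intro i _
      have hqi := (hq i).1
      have hri := hrpos i
      have hpi := (hp i).1
      have hwi := hw i
      have e1 : w i * (q i - r i) ^ 2 / (q i * r i ^ 2)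
          = (w i / q i - w i / r i) + w i / r i ^ 2 * (q i - r i) := by
        field_simp
        ring
      have e2 : w i = 2 * N / t ^ 2 / p i * (t * s i) ^ 2 := by
        rw [mul_pow, hssq]
        field_simp
      have e3 : w i / r i ^ 2 * (q i - r i) ≤ 2 * N / t ^ 2 / p i * (q i - r i) := by
        rcases le_total (lam i) (t * s i) with h | h
        · have hrl : r i = lam i := min_eq_left h
          refine mul_le_mul_of_nonpos_right ?_ (by linarith [(hq i).2])
          rw [le_div_iff₀ (by positivity)]
          have h5 : r i ^ 2 ≤ (t * s i) ^ 2 := by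
            rw [hrl]
            exact pow_le_pow_left₀ (hlam i).1.le h 2
          calc _ ≤ 2 * N / t ^ 2 / p i * (t * s i) ^ 2 :=
                mul_le_mul_of_nonneg_left h5 (by positivity)
            _ = w i := e2.symm
        · have hrl : r i = t * s i := min_eq_right h
          rw [← hrl] at e2
          have e4 : w i / r i ^ 2 = 2 * N / t ^ 2 / p i := by
            rw [div_eq_iff (by positivity)]
            exact e2
          rw [e4]
      have e5 : 2 * N / t ^ 2 * (q i / p i - r i / p i)
          = 2 * N / t ^ 2 / p i * (q i - r i) := by ring
      rw [e1, e5]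
      linarith
    have hsum := Finset.sum_le_sum hterm
    rw [Finset.sum_add_distrib, ← Finset.mul_sum, Finset.sum_sub_distrib
      (fun i => q i / p i), hrs] at hsum
    have h6 : 2 * N / t ^ 2 * (∑ i, q i / p i - 1) ≤ 0 :=
      mul_nonpos_of_nonneg_of_nonpos (by positivity) (by linarith)
    have hnn : ∀ i ∈ Finset.univ, 0 ≤ w i * (q i - r i) ^ 2 / (q i * r i ^ 2) := by
      intro i _
      have hqi := (hq i).1
      have hri := hrpos i
      have hwi := hw i
      positivity
    have h7 := (Finset.sum_eq_zero_iff_of_nonneg hnn).1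
      (le_antisymm (by linarith) (Finset.sum_nonneg hnn))
    have hqr : ∀ i, q i = r i := by
      intro i
      have h8 := h7 i (Finset.mem_univ i)
      have hqi := (hq i).1
      have hri := hrpos i
      have hwi := hw i
      rw [div_eq_zero_iff] at h8
      rcases h8 with h8 | h8
      · rcases mul_eq_zero.1 h8 with h9 | h9
        · exact absurd h9 hwi.ne'
        · exact sub_eq_zero.1 (pow_eq_zero_iff (two_ne_zero) |>.1 h9)
      · exact absurd h8 (by positivity)
    refine ⟨1 / t ^ 2, by positivity, fun i => ?_, ?_⟩
    · rw [hqr i]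
      have h9 : w i * p i / (2 * (N : ℝ) * (1 / t ^ 2)) = t ^ 2 * (w i * p i / (2 * (N : ℝ))) := by
        field_simp
      rw [h9, Real.sqrt_mul (sq_nonneg t), Real.sqrt_sq htpos.le]
    · rw [← hrs]
      exact Finset.sum_congr rfl fun i _ => by rw [hqr i]
end

section
/- Let N ≥ 1 be an integer and let w_i > 0, p_i ∈ (0,1], λ_i ∈ (0,1] for i = 1,...,N. Over the set M = {μ ∈ ℝ^N : μ_i > 0 for all i and Σ_{i=1}^N μ_i ≤ 1}, the function g(μ) = (1/N) Σ_{i=1}^N w_i ( 1/λ_i − 1 + 1/(p_i μ_i) ) attains its minimum at the unique point μ^S given by μ^S_i = √(w_i/p_i) / Σ_{j=1}^N √(w_j/p_j), and the minimum value equals (1/N) Σ_{i=1}^N w_i (1/λ_i − 1) + (1/N) ( Σ_{i=1}^N √(w_i/p_i) )². In particular, the minimizer μ^S does not depend on the arrival rates λ_1,...,λ_N. -/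
/-- The Optimal Stationary Randomized policy for Single packet queues: over
`M = {μ : μ_i > 0, Σ μ_i ≤ 1}`, the EWSAoI `(1/N) Σ w_i (1/λ_i − 1 + 1/(p_i μ_i))`
is uniquely minimized at `μ^S_i = √(w_i/p_i) / Σ_j √(w_j/p_j)` (which does not
depend on the arrival rates λ), with minimum value
`(1/N) Σ w_i (1/λ_i − 1) + (1/N) (Σ √(w_i/p_i))²`. -/
theorem optimal_randomized_single_packet_queue
    (N : ℕ) (hN : 1 ≤ N) (w p lam : Fin N → ℝ)
    (hw : ∀ i, 0 < w i)
    (hp : ∀ i, 0 < p i ∧ p i ≤ 1)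
    (hlam : ∀ i, 0 < lam i ∧ lam i ≤ 1)
    (muS : Fin N → ℝ)
    (hmuS : ∀ i, muS i = Real.sqrt (w i / p i) / ∑ j, Real.sqrt (w j / p j)) :
    ((∀ i, 0 < muS i) ∧ ∑ i, muS i ≤ 1) ∧
    (∀ mu : Fin N → ℝ, (∀ i, 0 < mu i) → ∑ i, mu i ≤ 1 →
      (1 / (N : ℝ)) * ∑ i, w i * (1 / lam i - 1 + 1 / (p i * muS i)) ≤
        (1 / (N : ℝ)) * ∑ i, w i * (1 / lam i - 1 + 1 / (p i * mu i))) ∧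
    (∀ mu : Fin N → ℝ, (∀ i, 0 < mu i) → ∑ i, mu i ≤ 1 →
      (1 / (N : ℝ)) * ∑ i, w i * (1 / lam i - 1 + 1 / (p i * mu i)) =
        (1 / (N : ℝ)) * ∑ i, w i * (1 / lam i - 1 + 1 / (p i * muS i)) →
      mu = muS) ∧
    (1 / (N : ℝ)) * ∑ i, w i * (1 / lam i - 1 + 1 / (p i * muS i)) =
      (1 / (N : ℝ)) * ∑ i, w i * (1 / lam i - 1) +
        (1 / (N : ℝ)) * (∑ i, Real.sqrt (w i / p i)) ^ 2 := by
  have hs : ∀ i, 0 < Real.sqrt (w i / p i) := fun i =>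
    Real.sqrt_pos.2 (div_pos (hw i) (hp i).1)
  have hs2 : ∀ i, Real.sqrt (w i / p i) ^ 2 = w i / p i := fun i =>
    Real.sq_sqrt (div_pos (hw i) (hp i).1).le
  have hNpos : (0 : ℝ) < 1 / (N : ℝ) := by
    have : (0 : ℝ) < N := by exact_mod_cast hN
    positivity
  obtain ⟨s, hsi⟩ : ∃ s : Fin N → ℝ, ∀ i, Real.sqrt (w i / p i) = s i := ⟨_, fun _ => rfl⟩
  simp only [hsi] at hs hs2 hmuS ⊢
  obtain ⟨S, hS⟩ : ∃ S, S = ∑ j, s j := ⟨_, rfl⟩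
  simp only [← hS] at hmuS ⊢
  have hSpos : 0 < S := by
    rw [hS]
    exact Finset.sum_pos (fun i _ => hs i) ⟨⟨0, hN⟩, Finset.mem_univ _⟩
  have hpos : ∀ i, 0 < muS i := fun i => by
    rw [hmuS i]; exact div_pos (hs i) hSpos
  have hsum : ∑ i, muS i = 1 := by
    rw [Finset.sum_congr rfl (fun i _ => hmuS i), ← Finset.sum_div, ← hS]
    exact div_self hSpos.ne'
  have key : ∀ mu : Fin N → ℝ, (∀ i, 0 < mu i) →
      ∑ i, w i * (1 / lam i - 1 + 1 / (p i * mu i)) =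
        ∑ i, w i * (1 / lam i - 1) + (2 * S ^ 2 - S ^ 2 * ∑ i, mu i) +
          ∑ i, (s i - S * mu i) ^ 2 / mu i := by
    intro mu hmu
    have h1 : 2 * S ^ 2 - S ^ 2 * ∑ i, mu i = ∑ i, (2 * S * s i - S ^ 2 * mu i) := by
      rw [Finset.sum_sub_distrib, ← Finset.mul_sum, ← Finset.mul_sum, ← hS]; ring
    rw [h1, ← Finset.sum_add_distrib, ← Finset.sum_add_distrib]
    refine Finset.sum_congr rfl fun i _ => ?_
    have hm := (hmu i).ne'
    have hpi := (hp i).1.ne'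
    have hwi : w i * (1 / (p i * mu i)) = s i ^ 2 / mu i := by
      rw [hs2 i]; field_simp
    rw [mul_add, hwi]
    have : s i ^ 2 / mu i = 2 * S * s i - S ^ 2 * mu i + (s i - S * mu i) ^ 2 / mu i := by
      field_simp; ring
    rw [this]; ring
  have hval : ∑ i, w i * (1 / lam i - 1 + 1 / (p i * muS i)) =
      ∑ i, w i * (1 / lam i - 1) + S ^ 2 := by
    rw [key muS hpos, hsum]
    have : ∑ i, (s i - S * muS i) ^ 2 / muS i = 0 := by
      refine Finset.sum_eq_zero fun i _ => ?_
      have : s i - S * muS i = 0 := by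
        rw [hmuS i, mul_div_cancel₀ _ hSpos.ne', sub_self]
      rw [this]; simp
    rw [this]; ring
  have hnn : ∀ mu : Fin N → ℝ, (∀ i, 0 < mu i) →
      ∀ i ∈ Finset.univ, 0 ≤ (s i - S * mu i) ^ 2 / mu i := fun mu hmu i _ =>
    div_nonneg (sq_nonneg _) (hmu i).le
  refine ⟨⟨hpos, hsum.le⟩, ?_, ?_, ?_⟩
  · intro mu hmu hle
    refine mul_le_mul_of_nonneg_left ?_ hNpos.le
    rw [hval, key mu hmu]
    have := Finset.sum_nonneg (hnn mu hmu)
    nlinarith [mul_le_mul_of_nonneg_left hle (sq_nonneg S)]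
  · intro mu hmu hle heq
    have heq := mul_left_cancel₀ hNpos.ne' heq
    rw [hval, key mu hmu] at heq
    have h0 := Finset.sum_nonneg (hnn mu hmu)
    have hz : ∑ i, (s i - S * mu i) ^ 2 / mu i = 0 := by
      nlinarith [mul_le_mul_of_nonneg_left hle (sq_nonneg S)]
    have hz' := (Finset.sum_eq_zero_iff_of_nonneg (hnn mu hmu)).1 hz
    funext i
    have h := hz' i (Finset.mem_univ i)
    rw [div_eq_zero_iff] at h
    have h := pow_eq_zero_iff (two_ne_zero) |>.1 (h.resolve_right (hmu i).ne')
    rw [hmuS i, eq_div_iff hSpos.ne']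
    linarith
  · rw [hval]; ring
end

section
/- Let N ≥ 1 be an integer and let w_i > 0, p_i ∈ (0,1], λ_i ∈ (0,1] for i = 1,...,N. Over the set M = {μ ∈ ℝ^N : μ_i > 0 for all i and Σ_{i=1}^N μ_i ≤ 1}, the function g(μ) = (1/N) Σ_{i=1}^N w_i / (p_i λ_i μ_i) attains its minimum at the unique point μ^N given by μ^N_i = √(w_i/(p_i λ_i)) / Σ_{j=1}^N √(w_j/(p_j λ_j)), and the minimum value equals (1/N) ( Σ_{i=1}^N √(w_i/(p_i λ_i)) )². -/
/-- The Optimal Stationary Randomized policy for the No queue discipline: over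
`M = {μ : μ_i > 0, Σ μ_i ≤ 1}`, the EWSAoI `(1/N) Σ w_i/(p_i λ_i μ_i)` is uniquely
minimized at `μ^N_i = √(w_i/(p_i λ_i)) / Σ_j √(w_j/(p_j λ_j))`, with minimum value
`(1/N) (Σ √(w_i/(p_i λ_i)))²`. -/
theorem optimal_randomized_no_queue
    (N : ℕ) (hN : 1 ≤ N) (w p lam : Fin N → ℝ)
    (hw : ∀ i, 0 < w i)
    (hp : ∀ i, 0 < p i ∧ p i ≤ 1)
    (hlam : ∀ i, 0 < lam i ∧ lam i ≤ 1)
    (muN : Fin N → ℝ)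
    (hmuN : ∀ i, muN i =
      Real.sqrt (w i / (p i * lam i)) / ∑ j, Real.sqrt (w j / (p j * lam j))) :
    ((∀ i, 0 < muN i) ∧ ∑ i, muN i ≤ 1) ∧
    (∀ mu : Fin N → ℝ, (∀ i, 0 < mu i) → ∑ i, mu i ≤ 1 →
      (1 / (N : ℝ)) * ∑ i, w i / (p i * lam i * muN i) ≤
        (1 / (N : ℝ)) * ∑ i, w i / (p i * lam i * mu i)) ∧
    (∀ mu : Fin N → ℝ, (∀ i, 0 < mu i) → ∑ i, mu i ≤ 1 →
      (1 / (N : ℝ)) * ∑ i, w i / (p i * lam i * mu i) =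
        (1 / (N : ℝ)) * ∑ i, w i / (p i * lam i * muN i) →
      mu = muN) ∧
    (1 / (N : ℝ)) * ∑ i, w i / (p i * lam i * muN i) =
      (1 / (N : ℝ)) * (∑ i, Real.sqrt (w i / (p i * lam i))) ^ 2 := by
  have hNpos : (0 : ℝ) < 1 / (N : ℝ) := by
    have : (0 : ℝ) < N := by exact_mod_cast hN
    positivity
  have hne : (Finset.univ : Finset (Fin N)).Nonempty := ⟨⟨0, hN⟩, Finset.mem_univ _⟩
  obtain ⟨a, ha⟩ : ∃ a : Fin N → ℝ, ∀ i, a i = Real.sqrt (w i / (p i * lam i)) :=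
    ⟨_, fun _ => rfl⟩
  have hq : ∀ i, 0 < w i / (p i * lam i) := fun i =>
    div_pos (hw i) (mul_pos (hp i).1 (hlam i).1)
  have hapos : ∀ i, 0 < a i := fun i => by rw [ha]; exact Real.sqrt_pos.2 (hq i)
  have hterm : ∀ (i : Fin N) (x : ℝ), w i / (p i * lam i * x) = a i ^ 2 / x := fun i x => by
    rw [ha, Real.sq_sqrt (hq i).le, div_div]
  simp only [← ha] at hmuN ⊢
  simp only [hterm]
  obtain ⟨S, hS⟩ : ∃ S : ℝ, S = ∑ j, a j := ⟨_, rfl⟩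
  have hSpos : 0 < S := by rw [hS]; exact Finset.sum_pos (fun i _ => hapos i) hne
  rw [← hS]
  simp only [← hS] at hmuN
  have hval : ∑ i, a i ^ 2 / muN i = S ^ 2 := by
    have h : ∀ i, a i ^ 2 / muN i = a i * S := fun i => by
      have := (hapos i).ne'
      rw [hmuN]; field_simp
    simp only [h]
    rw [← Finset.sum_mul, ← hS, sq]
  have hkey : ∀ mu : Fin N → ℝ, (∀ i, 0 < mu i) → ∑ i, mu i ≤ 1 →
      S ^ 2 + ∑ i, (a i - S * mu i) ^ 2 / mu i ≤ ∑ i, a i ^ 2 / mu i := by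
    intro mu hmu hsum
    have h : ∀ i, a i ^ 2 / mu i =
        2 * S * a i - S ^ 2 * mu i + (a i - S * mu i) ^ 2 / mu i := fun i => by
      have := (hmu i).ne'
      field_simp; ring
    have h2 : ∑ i, a i ^ 2 / mu i =
        2 * S * S - S ^ 2 * ∑ i, mu i + ∑ i, (a i - S * mu i) ^ 2 / mu i := by
      rw [Finset.sum_congr rfl (fun i _ => h i), Finset.sum_add_distrib,
        Finset.sum_sub_distrib, ← Finset.mul_sum, ← Finset.mul_sum, ← hS]
    rw [h2]
    nlinarith [mul_le_mul_of_nonneg_left hsum (sq_nonneg S)]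
  have hnn : ∀ mu : Fin N → ℝ, (∀ i, 0 < mu i) →
      ∀ i ∈ Finset.univ, 0 ≤ (a i - S * mu i) ^ 2 / mu i := fun mu hmu i _ =>
    div_nonneg (sq_nonneg _) (hmu i).le
  refine ⟨⟨fun i => ?_, ?_⟩, ?_, ?_, ?_⟩
  · rw [hmuN]; exact div_pos (hapos i) hSpos
  · simp only [hmuN]
    rw [← Finset.sum_div, ← hS, div_self hSpos.ne']
  · intro mu hmu hsum
    rw [hval]
    refine mul_le_mul_of_nonneg_left ?_ hNpos.le
    linarith [hkey mu hmu hsum, Finset.sum_nonneg (hnn mu hmu)]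
  · intro mu hmu hsum heq
    have heq' := mul_left_cancel₀ hNpos.ne' heq
    rw [hval] at heq'
    have hz : ∑ i, (a i - S * mu i) ^ 2 / mu i = 0 :=
      le_antisymm (by linarith [hkey mu hmu hsum]) (Finset.sum_nonneg (hnn mu hmu))
    funext i
    have hi := (Finset.sum_eq_zero_iff_of_nonneg (hnn mu hmu)).1 hz i (Finset.mem_univ i)
    rw [div_eq_zero_iff, or_iff_left (hmu i).ne', sq_eq_zero_iff] at hi
    rw [hmuN, eq_div_iff hSpos.ne']
    linarith
  · rw [hval]
end

section
/- Let N ≥ 1 be an integer and let w_i > 0, p_i ∈ (0,1], λ_i ∈ (0,1] for i = 1,...,N. Let A = min over {μ ∈ ℝ^N : μ_i > 0, Σ_i μ_i ≤ 1} of (1/N) Σ_{i=1}^N w_i (1/λ_i − 1 + 1/(p_i μ_i)), and let B = min over {q ∈ ℝ^N : 0 < q_i ≤ λ_i for all i, Σ_i q_i/p_i ≤ 1} of (1/(2N)) Σ_{i=1}^N w_i (1/q_i + 1). Then A < 4B. -/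
/-- Factor-4 optimality of the Optimal Stationary Randomized policy for Single
packet queues: its EWSAoI `A` is strictly less than four times the Age of
Information lower bound `B`. -/
theorem randomized_within_factor_four_of_lower_bound
    (N : ℕ) (hN : 1 ≤ N) (w p lam : Fin N → ℝ)
    (hw : ∀ i, 0 < w i)
    (hp : ∀ i, 0 < p i ∧ p i ≤ 1)
    (hlam : ∀ i, 0 < lam i ∧ lam i ≤ 1)
    (A B : ℝ)
    (hA : IsLeast {x : ℝ | ∃ mu : Fin N → ℝ, (∀ i, 0 < mu i) ∧ (∑ i, mu i ≤ 1) ∧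
      x = (1 / (N : ℝ)) * ∑ i, w i * (1 / lam i - 1 + 1 / (p i * mu i))} A)
    (hB : IsLeast {x : ℝ | ∃ q : Fin N → ℝ, (∀ i, 0 < q i ∧ q i ≤ lam i) ∧
      (∑ i, q i / p i ≤ 1) ∧
      x = (1 / (2 * (N : ℝ))) * ∑ i, w i * (1 / q i + 1)} B) :
    A < 4 * B := by
  obtain ⟨⟨q, hq, hsum, rfl⟩, -⟩ := hB
  have hNpos : (0 : ℝ) < N := by exact_mod_cast hN
  have hle := hA.2 ⟨fun i => q i / p i, fun i => div_pos (hq i).1 (hp i).1, hsum, rfl⟩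
  refine lt_of_le_of_lt hle ?_
  have h4 : 4 * ((1 / (2 * (N : ℝ))) * ∑ i, w i * (1 / q i + 1))
      = (1 / (N : ℝ)) * ∑ i, w i * (2 * (1 / q i + 1)) := by
    have h2 : ∑ i, w i * (2 * (1 / q i + 1)) = 2 * ∑ i, w i * (1 / q i + 1) := by
      rw [Finset.mul_sum]
      exact Finset.sum_congr rfl fun i _ => by ring
    rw [h2]
    field_simp
    ring
  rw [h4]
  refine mul_lt_mul_of_pos_left ?_ (by positivity)
  refine Finset.sum_lt_sum_of_nonempty ⟨⟨0, hN⟩, Finset.mem_univ _⟩ fun i _ => ?_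
  refine mul_lt_mul_of_pos_left ?_ (hw i)
  have h1 : p i * (q i / p i) = q i := mul_div_cancel₀ _ (hp i).1.ne'
  have h3 : 1 / lam i ≤ 1 / q i := one_div_le_one_div_of_le (hq i).1 (hq i).2
  simp only [h1]
  linarith
end

section
/- Let λ ∈ (0,1] and s ∈ (0,1]. Then Σ_{h=1}^∞ h · λ s ( Σ_{n=0}^{h−1} (1−λ)^{h−1−n} (1−s)^n ) = 1/s + 1/λ − 1. -/
/-- The stationary expected Age of Information of a stream with Bernoulli(λ)
arrivals and per-slot delivery success probability `s` under the Single packet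
queue discipline: `Σ_{h≥1} h P(h) = 1/s + 1/λ − 1`, where
`P(h) = λ s Σ_{n=0}^{h−1} (1−λ)^{h−1−n}(1−s)^n` (written here with `h = k + 1`). -/
theorem aoi_stationary_expectation
    (lam s : ℝ) (hlam : lam ∈ Set.Ioc (0 : ℝ) 1) (hs : s ∈ Set.Ioc (0 : ℝ) 1) :
    ∑' k : ℕ, ((k : ℝ) + 1) * (lam * s *
      (∑ n ∈ Finset.range (k + 1), (1 - lam) ^ (k - n) * (1 - s) ^ n)) =
    1 / s + 1 / lam - 1 := by
  obtain ⟨hl0, hl1⟩ := hlam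
  obtain ⟨hs0, hs1⟩ := hs
  have ha : ‖1 - lam‖ < 1 := by
    rw [Real.norm_eq_abs, abs_lt]; constructor <;> linarith
  have hb : ‖1 - s‖ < 1 := by
    rw [Real.norm_eq_abs, abs_lt]; constructor <;> linarith
  have sa := summable_norm_geometric_of_norm_lt_one ha
  have sb := summable_norm_geometric_of_norm_lt_one hb
  have sa1 : Summable fun n : ℕ => ‖(n : ℝ) * (1 - lam) ^ n‖ := by
    simpa using summable_norm_pow_mul_geometric_of_norm_lt_one 1 ha
  have sb1 : Summable fun n : ℕ => ‖(n : ℝ) * (1 - s) ^ n‖ := by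
    simpa using summable_norm_pow_mul_geometric_of_norm_lt_one 1 hb
  have h1 := hasSum_sum_range_mul_of_summable_norm sb1 sa
  have h2 := hasSum_sum_range_mul_of_summable_norm sb sa1
  have h3 := hasSum_sum_range_mul_of_summable_norm sb sa
  rw [tsum_coe_mul_geometric_of_norm_lt_one hb, tsum_geometric_of_norm_lt_one ha] at h1
  rw [tsum_coe_mul_geometric_of_norm_lt_one ha, tsum_geometric_of_norm_lt_one hb] at h2
  rw [tsum_geometric_of_norm_lt_one ha, tsum_geometric_of_norm_lt_one hb] at h3
  have h := ((h1.add h2).add h3).mul_left (lam * s)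
  have hv : lam * s * ((1 - s) / (1 - (1 - s)) ^ 2 * (1 - (1 - lam))⁻¹ +
      (1 - (1 - s))⁻¹ * ((1 - lam) / (1 - (1 - lam)) ^ 2) +
      (1 - (1 - s))⁻¹ * (1 - (1 - lam))⁻¹) = 1 / s + 1 / lam - 1 := by
    rw [sub_sub_cancel, sub_sub_cancel]
    field_simp
    ring
  rw [← hv, ← h.tsum_eq]
  refine tsum_congr fun k => ?_
  rw [mul_left_comm, Finset.mul_sum, ← Finset.sum_add_distrib, ← Finset.sum_add_distrib]
  congr 1
  refine Finset.sum_congr rfl fun n hn => ?_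
  have hnk : n ≤ k := Nat.lt_succ_iff.mp (Finset.mem_range.mp hn)
  rw [Nat.cast_sub hnk]
  ring
end

section
/- Let N ≥ 1 be an integer and let w_i > 0, p_i ∈ (0,1], λ_i ∈ (0,1] for i = 1,...,N, and set γ_i = w_i p_i / (2N λ_i²). If Σ_{i=1}^N λ_i/p_i > 1, then there exists a unique γ > 0 such that Σ_{i=1}^N (λ_i/p_i) · min{ 1, √(γ_i/γ) } = 1. -/
/-- Correctness of the multiplier search in Algorithm 1: if `Σ λ_i/p_i > 1`, there
is a unique `γ > 0` at which the candidate throughputs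
`q_i(γ) = λ_i min{1, √(γ_i/γ)}`, with `γ_i = w_i p_i/(2N λ_i²)`, satisfy the
resource constraint `Σ q_i(γ)/p_i = 1` with equality. -/
theorem lower_bound_multiplier_exists_unique
    (N : ℕ) (hN : 1 ≤ N) (w p lam : Fin N → ℝ)
    (hw : ∀ i, 0 < w i)
    (hp : ∀ i, 0 < p i ∧ p i ≤ 1)
    (hlam : ∀ i, 0 < lam i ∧ lam i ≤ 1)
    (γi : Fin N → ℝ)
    (hγi : ∀ i, γi i = w i * p i / (2 * (N : ℝ) * (lam i) ^ 2))
    (hinfeas : 1 < ∑ i, lam i / p i) :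
    ∃! γ : ℝ, 0 < γ ∧
      ∑ i, (lam i / p i) * min 1 (Real.sqrt (γi i / γ)) = 1 := by
  have hNpos : (0 : ℝ) < N := by exact_mod_cast hN
  have hγ : ∀ i, 0 < γi i := by
    intro i
    rw [hγi i]
    have h1 := hw i
    have h2 := (hp i).1
    have h3 := (hlam i).1
    positivity
  have hc : ∀ i, 0 < lam i / p i := fun i => div_pos (hlam i).1 (hp i).1
  set F : ℝ → ℝ := fun γ => ∑ i, (lam i / p i) * min 1 (Real.sqrt (γi i / γ)) with hF
  -- strict decrease from any point where the constraint is met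
  have key : ∀ a b : ℝ, 0 < a → a < b → F a = 1 → F b < 1 := by
    intro a b ha hab hFa
    have hlt : ∃ i, Real.sqrt (γi i / a) < 1 := by
      by_contra! hcon
      have : F a = ∑ i, lam i / p i := by
        simp only [hF]
        refine Finset.sum_congr rfl fun i _ => ?_
        rw [min_eq_left (hcon i), mul_one]
      linarith
    obtain ⟨j, hj⟩ := hlt
    have hs : ∀ i, Real.sqrt (γi i / b) < Real.sqrt (γi i / a) := fun i =>
      Real.sqrt_lt_sqrt (div_pos (hγ i) (ha.trans hab)).le
        (div_lt_div_of_pos_left (hγ i) ha hab)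
    rw [← hFa]
    refine Finset.sum_lt_sum (fun i _ => ?_) ⟨j, Finset.mem_univ j, ?_⟩
    · exact mul_le_mul_of_nonneg_left (min_le_min le_rfl (hs i).le) (hc i).le
    · refine mul_lt_mul_of_pos_left ?_ (hc j)
      rw [min_eq_right hj.le]
      exact (min_le_right _ _).trans_lt (hs j)
  have hlim : Filter.Tendsto F Filter.atTop (nhds 0) := by
    have h : Filter.Tendsto F Filter.atTop
        (nhds (∑ i, (lam i / p i) * min 1 (Real.sqrt 0))) := by
      refine tendsto_finsetSum _ fun i _ => ?_
      refine Filter.Tendsto.const_mul _ ?_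
      refine Filter.Tendsto.min tendsto_const_nhds ?_
      exact (Real.continuous_sqrt.tendsto 0).comp
        (tendsto_const_nhds.div_atTop Filter.tendsto_id)
    simpa using h
  obtain ⟨a, ha, hai⟩ : ∃ a : ℝ, 0 < a ∧ ∀ i, a < γi i := by
    have h1 : ∀ᶠ x in nhdsWithin (0 : ℝ) (Set.Ioi 0), ∀ i, x < γi i :=
      Filter.eventually_all.2 fun i =>
        nhdsWithin_le_nhds (eventually_lt_nhds (hγ i))
    obtain ⟨a, h, h'⟩ := (h1.and self_mem_nhdsWithin).exists
    exact ⟨a, h', h⟩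
  have hFa : 1 < F a := by
    have : F a = ∑ i, lam i / p i := by
      simp only [hF]
      refine Finset.sum_congr rfl fun i _ => ?_
      rw [min_eq_left, mul_one]
      rw [Real.one_le_sqrt, one_le_div ha]
      exact (hai i).le
    linarith
  obtain ⟨b, hFb, hab⟩ :=
    ((hlim.eventually (eventually_lt_nhds zero_lt_one)).and
      (Filter.eventually_ge_atTop a)).exists
  have hcont : ContinuousOn F (Set.Icc a b) := by
    refine continuousOn_finsetSum _ fun i _ => ?_
    refine continuousOn_const.mul (ContinuousOn.inf continuousOn_const ?_)
    refine Real.continuous_sqrt.comp_continuousOn ?_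
    exact continuousOn_const.div continuousOn_id fun x hx => (ha.trans_le hx.1).ne'
  obtain ⟨g, hg, hFg⟩ := intermediate_value_Icc' hab hcont ⟨hFb.le, hFa.le⟩
  refine ⟨g, ⟨ha.trans_le hg.1, hFg⟩, ?_⟩
  rintro y ⟨hy, hFy⟩
  rcases lt_trichotomy y g with h | h | h
  · exact absurd hFg (key y g hy h hFy).ne
  · exact h
  · exact absurd hFy (key g y (ha.trans_le hg.1) h hFg).ne
end

section
/- Let N ≥ 1 be an integer and let w_i > 0, p_i ∈ (0,1], λ_i ∈ (0,1] for i = 1,...,N, and set γ̃ = (1/(2N)) ( Σ_{i=1}^N √(w_i/p_i) )². If λ_i ≥ √( w_i p_i / (2N γ̃) ) for every i, then the unique minimizer of f(q) = (1/(2N)) Σ_{i=1}^N w_i (1/q_i + 1) over F = {q ∈ ℝ^N : 0 < q_i ≤ λ_i for all i, Σ_{i=1}^N q_i/p_i ≤ 1} is given by q*_i = √(w_i p_i) / Σ_{j=1}^N √(w_j/p_j), and the minimum value equals (1/(2N)) [ ( Σ_{i=1}^N √(w_i/p_i) )² + Σ_{i=1}^N w_i ]. -/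
/-- The interior regime of the Age of Information lower-bound problem: if
`λ_i ≥ √(w_i p_i/(2N γ̃))` for all `i`, where `γ̃ = (Σ √(w_i/p_i))²/(2N)`, then the
unique minimizer of `f(q) = (1/(2N)) Σ w_i (1/q_i + 1)` over
`F = {q : 0 < q_i ≤ λ_i, Σ q_i/p_i ≤ 1}` is `q*_i = √(w_i p_i)/Σ_j √(w_j/p_j)`,
with minimum value `(1/(2N)) [(Σ √(w_i/p_i))² + Σ w_i]`. -/
theorem lower_bound_interior_regime
    (N : ℕ) (hN : 1 ≤ N) (w p lam : Fin N → ℝ)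
    (hw : ∀ i, 0 < w i)
    (hp : ∀ i, 0 < p i ∧ p i ≤ 1)
    (hlam : ∀ i, 0 < lam i ∧ lam i ≤ 1)
    (γtil : ℝ)
    (hγtil : γtil = (1 / (2 * (N : ℝ))) * (∑ i, Real.sqrt (w i / p i)) ^ 2)
    (hreg : ∀ i, Real.sqrt (w i * p i / (2 * (N : ℝ) * γtil)) ≤ lam i)
    (qs : Fin N → ℝ)
    (hqs : ∀ i, qs i = Real.sqrt (w i * p i) / ∑ j, Real.sqrt (w j / p j)) :
    ((∀ i, 0 < qs i ∧ qs i ≤ lam i) ∧ ∑ i, qs i / p i ≤ 1) ∧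
    (∀ q : Fin N → ℝ, ((∀ i, 0 < q i ∧ q i ≤ lam i) ∧ ∑ i, q i / p i ≤ 1) →
      (1 / (2 * (N : ℝ))) * ∑ i, w i * (1 / qs i + 1) ≤
        (1 / (2 * (N : ℝ))) * ∑ i, w i * (1 / q i + 1)) ∧
    (∀ q : Fin N → ℝ, ((∀ i, 0 < q i ∧ q i ≤ lam i) ∧ ∑ i, q i / p i ≤ 1) →
      (1 / (2 * (N : ℝ))) * ∑ i, w i * (1 / q i + 1) =
        (1 / (2 * (N : ℝ))) * ∑ i, w i * (1 / qs i + 1) →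
      q = qs) ∧
    (1 / (2 * (N : ℝ))) * ∑ i, w i * (1 / qs i + 1) =
      (1 / (2 * (N : ℝ))) * ((∑ i, Real.sqrt (w i / p i)) ^ 2 + ∑ i, w i) := by
  have hN0 : (0 : ℝ) < 2 * (N : ℝ) := by
    have : (0 : ℝ) < N := by exact_mod_cast hN
    linarith
  obtain ⟨a, ha⟩ : ∃ a : Fin N → ℝ, ∀ i, a i = Real.sqrt (w i / p i) := ⟨_, fun _ => rfl⟩
  have hapos : ∀ i, 0 < a i := fun i => by
    rw [ha]; exact Real.sqrt_pos.mpr (div_pos (hw i) (hp i).1)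
  have hwa : ∀ i, w i = a i ^ 2 * p i := fun i => by
    rw [ha, Real.sq_sqrt (div_pos (hw i) (hp i).1).le, div_mul_cancel₀ _ (hp i).1.ne']
  have hwp : ∀ i, Real.sqrt (w i * p i) = a i * p i := fun i => by
    rw [hwa i, show a i ^ 2 * p i * p i = (a i * p i) ^ 2 by ring]
    exact Real.sqrt_sq (mul_pos (hapos i) (hp i).1).le
  simp only [← ha] at hγtil hqs ⊢
  obtain ⟨S, hS⟩ : ∃ S, S = ∑ i, a i := ⟨_, rfl⟩
  rw [← hS] at hγtil ⊢
  simp only [← hS, hwp] at hqs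
  have hSpos : 0 < S := by
    rw [hS]
    exact Finset.sum_pos (fun i _ => hapos i) ⟨⟨0, hN⟩, Finset.mem_univ _⟩
  have hqpos : ∀ i, 0 < qs i := fun i => by
    rw [hqs]; exact div_pos (mul_pos (hapos i) (hp i).1) hSpos
  have hqle : ∀ i, qs i ≤ lam i := fun i => by
    have h := hreg i
    have h2 : 2 * (N : ℝ) * γtil = S ^ 2 := by
      rw [hγtil]; field_simp
    rwa [h2, Real.sqrt_div' _ (sq_nonneg S), Real.sqrt_sq hSpos.le, hwp, ← hqs] at h
  have hsum : ∑ i, qs i / p i = 1 := by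
    have : ∀ i, qs i / p i = a i / S := fun i => by
      have := (hp i).1.ne'
      rw [hqs]; field_simp
    simp only [this]
    rw [← Finset.sum_div, ← hS, div_self hSpos.ne']
  have key : ∀ q : Fin N → ℝ, (∀ i, 0 < q i) → ∑ i, w i * (1 / q i + 1) =
      ∑ i, w i + 2 * S ^ 2 - S ^ 2 * ∑ i, q i / p i
        + ∑ i, (a i * p i - S * q i) ^ 2 / (p i * q i) := by
    intro q hq
    have h1 : ∀ i, w i * (1 / q i + 1) = w i + 2 * S * a i - S ^ 2 * (q i / p i)
        + (a i * p i - S * q i) ^ 2 / (p i * q i) := fun i => by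
      have := (hp i).1.ne'
      have := (hq i).ne'
      rw [hwa i]; field_simp; ring
    simp only [h1, Finset.sum_add_distrib, Finset.sum_sub_distrib, ← Finset.mul_sum]
    rw [← hS]; ring
  have hval : ∑ i, w i * (1 / qs i + 1) = S ^ 2 + ∑ i, w i := by
    rw [key qs hqpos, hsum]
    have : ∀ i, (a i * p i - S * qs i) ^ 2 / (p i * qs i) = 0 := fun i => by
      have : a i * p i - S * qs i = 0 := by rw [hqs]; field_simp; ring
      rw [this]; simp
    simp only [this, Finset.sum_const_zero]; ring
  have hnn : ∀ q : Fin N → ℝ, (∀ i, 0 < q i) → ∀ i ∈ Finset.univ,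
      0 ≤ (a i * p i - S * q i) ^ 2 / (p i * q i) := fun q hq i _ =>
    div_nonneg (sq_nonneg _) (mul_pos (hp i).1 (hq i)).le
  refine ⟨⟨fun i => ⟨hqpos i, hqle i⟩, hsum.le⟩, ?_, ?_, by rw [hval]⟩
  · rintro q ⟨hq, hq1⟩
    refine mul_le_mul_of_nonneg_left ?_ (by positivity)
    have h0 := Finset.sum_nonneg (hnn q fun i => (hq i).1)
    rw [hval, key q fun i => (hq i).1]
    nlinarith [mul_le_mul_of_nonneg_left hq1 (sq_nonneg S)]
  · rintro q ⟨hq, hq1⟩ heq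
    have heq := mul_left_cancel₀ (by positivity) heq
    have h0 := Finset.sum_nonneg (hnn q fun i => (hq i).1)
    rw [hval, key q fun i => (hq i).1] at heq
    have hz : ∑ i, (a i * p i - S * q i) ^ 2 / (p i * q i) = 0 := by
      nlinarith [mul_le_mul_of_nonneg_left hq1 (sq_nonneg S)]
    rw [Finset.sum_eq_zero_iff_of_nonneg (hnn q fun i => (hq i).1)] at hz
    funext i
    have h := hz i (Finset.mem_univ i)
    have h3 : a i * p i - S * q i = 0 := by
      rcases div_eq_zero_iff.mp h with h | h
      · exact pow_eq_zero_iff (two_ne_zero) |>.mp h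
      · exact absurd h (mul_pos (hp i).1 (hq i).1).ne'
    rw [hqs, eq_div_iff hSpos.ne']
    linarith
end
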